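/- arXiv:1804.05952 — 2 statements merged into one kernel-verified Lean document; each statement's English description precedes it below -/
import Mathlib

section
/- For all integers m ≥ 1 and k ≥ 2, B(m,k) ≤ ⌊k/2⌋·(m−1) + 1. Equivalently, player A has a strategy in the game B_{m,k} guaranteeing that, for every strategy of player B, among the first ⌊k/2⌋·(m−1) + 1 points played there is an m-up-run. -/
open Set

/-- A point in the plane. -/
abbrev Pt : Type := ℝ × ℝ

/-- The point set `P` contains an `n`-up-run: `n` points with strictly increasing
`x`-coordinates and nondecreasing `y`-coordinates. -/
def HasUpRun (P : Set Pt) (n : ℕ) : Prop :=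
  ∃ f : Fin n → Pt, (∀ i, f i ∈ P) ∧
    StrictMono (fun i => (f i).1) ∧ Monotone (fun i => (f i).2)

/-- The point set `P` contains an `n`-down-run: `n` points with strictly increasing
`x`-coordinates and strictly decreasing `y`-coordinates. -/
def HasDownRun (P : Set Pt) (n : ℕ) : Prop :=
  ∃ f : Fin n → Pt, (∀ i, f i ∈ P) ∧
    StrictMono (fun i => (f i).1) ∧ StrictAnti (fun i => (f i).2)

/-- A strategy for player A: from the list of previously played points, choose
an x-coordinate. -/
abbrev AStrat : Type := List Pt → ℝ

/-- A strategy for player B: from the list of previously played points and the new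
x-coordinate, choose a y-coordinate. -/
abbrev BStrat : Type := List Pt → ℝ → ℝ

/-- Validity of a strategy for player A in either game: the chosen x-coordinate lies in
`(0,1)` and is distinct from all previously played x-coordinates. -/
def AValid (sA : AStrat) : Prop :=
  ∀ h : List Pt, sA h ∈ Ioo (0:ℝ) 1 ∧ ∀ p ∈ h, sA h ≠ p.1

/-- Validity of a strategy for player B in the game `A_{m,k}`: the chosen y-coordinate
lies in `(0,1)` and is distinct from all previously played y-coordinates. -/
def BValid (sB : BStrat) : Prop :=
  ∀ (h : List Pt) (x : ℝ), sB h x ∈ Ioo (0:ℝ) 1 ∧ ∀ p ∈ h, sB h x ≠ p.2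

/-- The list of points played in the first `n` turns when A plays `sA` and B plays `sB`. -/
def hist (sA : AStrat) (sB : BStrat) : ℕ → List Pt
  | 0 => []
  | n + 1 =>
      let h := hist sA sB n
      h ++ [(sA h, sB h (sA h))]

/-- The set of points played in the first `N` turns. -/
def played (sA : AStrat) (sB : BStrat) (N : ℕ) : Set Pt :=
  {p | p ∈ hist sA sB N}

/-- In the game `A_{m,k}`, strategy `sA` of player A is valid and guarantees an
`m`-up-run or a `k`-down-run among the first `N` points, against every valid
strategy of player B. -/
def AWinsBy (m k N : ℕ) (sA : AStrat) : Prop :=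
  AValid sA ∧ ∀ sB : BStrat, BValid sB →
    HasUpRun (played sA sB N) m ∨ HasDownRun (played sA sB N) k

/-- The Erdős–Szekeres on-line number `ESO(m,k)`: the least `N` such that player A
has a strategy forcing an `m`-up-run or a `k`-down-run within `N` turns. -/
noncomputable def ESO (m k : ℕ) : ℕ := sInf {N | ∃ sA : AStrat, AWinsBy m k N sA}

/-- Validity of a strategy for player B in the tier game `B_{m,k}`: the chosen
y-coordinate is an integer in `{1, …, k-1}` (repetitions allowed). -/
def BTierValid (k : ℕ) (sB : BStrat) : Prop :=
  ∀ (h : List Pt) (x : ℝ), ∃ j : ℕ, 1 ≤ j ∧ j ≤ k - 1 ∧ sB h x = (j : ℝ)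

/-- In the tier game `B_{m,k}`, strategy `sA` of player A is valid and guarantees an
`m`-up-run among the first `N` points, against every valid strategy of player B. -/
def AWinsTierBy (m k N : ℕ) (sA : AStrat) : Prop :=
  AValid sA ∧ ∀ sB : BStrat, BTierValid k sB → HasUpRun (played sA sB N) m

/-- `B(m,k)`: the least `N` such that player A has a strategy forcing an `m`-up-run
within `N` turns of the tier game `B_{m,k}`. -/
noncomputable def BNum (m k : ℕ) : ℕ := sInf {N | ∃ sA : AStrat, AWinsTierBy m k N sA}

/-- The point `p` lies on a tier of odd index. -/
def OddTier (p : Pt) : Prop := ∃ i : ℕ, p.2 = 2 * i + 1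

/-- The coordinate `x` separates the points of `h` on odd tiers (to its left) from all other
points of `h` (to its right). -/
def IsCut (h : List Pt) (x : ℝ) : Prop :=
  x ∈ Ioo (0 : ℝ) 1 ∧ ∀ p ∈ h, (OddTier p → p.1 < x) ∧ (¬ OddTier p → x < p.1)

lemma IsCut.ne {h : List Pt} {x : ℝ} (hx : IsCut h x) : ∀ p ∈ h, x ≠ p.1 := by
  intro p hp
  by_cases ho : OddTier p
  · exact ((hx.2 p hp).1 ho).ne'
  · exact ((hx.2 p hp).2 ho).ne

lemma isOpen_setOf_isCut (h : List Pt) : IsOpen {x | IsCut h x} := by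
  have : {x | IsCut h x} = Ioo (0 : ℝ) 1 ∩
      ⋂ p ∈ {p | p ∈ h}, {x | (OddTier p → p.1 < x) ∧ (¬ OddTier p → x < p.1)} := by
    ext x
    simp [IsCut]
  rw [this]
  refine isOpen_Ioo.inter ((List.finite_toSet h).isOpen_biInter fun p _ => ?_)
  by_cases ho : OddTier p
  · simpa [ho] using isOpen_lt continuous_const continuous_id
  · simpa [ho] using isOpen_lt continuous_id continuous_const

lemma IsCut.exists_append {h : List Pt} {x : ℝ} (hx : IsCut h x) (y : ℝ) :
    ∃ z, IsCut (h ++ [(x, y)]) z := by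
  have hev : ∀ᶠ z in nhds x, IsCut h z := (isOpen_setOf_isCut h).mem_nhds hx
  by_cases ho : OddTier (x, y)
  · obtain ⟨z, hz, hxz⟩ := ((hev.filter_mono nhdsWithin_le_nhds).and
      (self_mem_nhdsWithin : Ioi x ∈ nhdsWithin x (Ioi x))).exists
    refine ⟨z, hz.1, fun p hp => ?_⟩
    rcases List.mem_append.1 hp with hp | hp
    · exact hz.2 p hp
    · obtain rfl := List.mem_singleton.1 hp
      exact ⟨fun _ => hxz, fun hn => absurd ho hn⟩
  · obtain ⟨z, hz, hxz⟩ := ((hev.filter_mono nhdsWithin_le_nhds).and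
      (self_mem_nhdsWithin : Iio x ∈ nhdsWithin x (Iio x))).exists
    refine ⟨z, hz.1, fun p hp => ?_⟩
    rcases List.mem_append.1 hp with hp | hp
    · exact hz.2 p hp
    · obtain rfl := List.mem_singleton.1 hp
      exact ⟨fun hn => absurd hn ho, fun _ => hxz⟩

/-- Player A can always play legally, and at a cut whenever there is one. -/
lemma exists_cut_move (h : List Pt) :
    ∃ x : ℝ, (x ∈ Ioo (0 : ℝ) 1 ∧ ∀ p ∈ h, x ≠ p.1) ∧ ((∃ z, IsCut h z) → IsCut h x) := by
  by_cases hc : ∃ z, IsCut h z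
  · obtain ⟨z, hz⟩ := hc
    exact ⟨z, ⟨hz.1, hz.ne⟩, fun _ => hz⟩
  · obtain ⟨x, hx, hxn⟩ :=
      (Ioo_infinite (zero_lt_one (α := ℝ))).exists_notMem_finset (h.map Prod.fst).toFinset
    refine ⟨x, ⟨hx, fun p hp hxp => hxn ?_⟩, fun h => absurd h hc⟩
    rw [List.mem_toFinset, hxp]
    exact List.mem_map_of_mem hp

lemma exists_isCut_hist {sA : AStrat} (hA : ∀ h, (∃ z, IsCut h z) → IsCut h (sA h))
    (sB : BStrat) (n : ℕ) : ∃ z, IsCut (hist sA sB n) z := by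
  induction n with
  | zero => exact ⟨1 / 2, by norm_num, by simp [hist]⟩
  | succ n ih => exact (hA _ ih).exists_append _

lemma length_hist (sA : AStrat) (sB : BStrat) (n : ℕ) : (hist sA sB n).length = n := by
  induction n with
  | zero => rfl
  | succ n ih => simp [hist, ih]

lemma nodup_map_fst_hist {sA : AStrat} (hA : AValid sA) (sB : BStrat) (n : ℕ) :
    ((hist sA sB n).map Prod.fst).Nodup := by
  induction n with
  | zero => simp [hist]
  | succ n ih =>
    simp only [hist, List.map_append, List.map_cons, List.map_nil]
    refine List.nodup_append.2 ⟨ih, List.nodup_singleton _, ?_⟩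
    intro a ha b hb hab
    obtain ⟨p, hp, rfl⟩ := List.mem_map.1 ha
    obtain rfl := List.mem_singleton.1 hb
    exact (hA _).2 p hp hab.symm

lemma exists_tier_of_mem_hist {k : ℕ} {sB : BStrat} (hB : BTierValid k sB) (sA : AStrat) (n : ℕ) :
    ∀ p ∈ hist sA sB n, ∃ j : ℕ, 1 ≤ j ∧ j ≤ k - 1 ∧ p.2 = j := by
  induction n with
  | zero => simp [hist]
  | succ n ih =>
    intro p hp
    rcases List.mem_append.1 hp with hp | hp
    · exact ih p hp
    · obtain rfl := List.mem_singleton.1 hp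
      exact hB _ _

lemma oddTier_iff {p : Pt} {j : ℕ} (hp : p.2 = j) : OddTier p ↔ Odd j := by
  constructor
  · rintro ⟨i, hi⟩
    exact ⟨i, by rw [hp] at hi; exact_mod_cast hi⟩
  · rintro ⟨i, rfl⟩
    exact ⟨i, by rw [hp]; push_cast; rfl⟩

/-- A finite set of points whose `y`-coordinates are nondecreasing as a function of the (distinct)
`x`-coordinates is an up-run. -/
lemma hasUpRun_of_finset {P : Set Pt} {n : ℕ} (S : Finset Pt) (hSP : ∀ p ∈ S, p ∈ P)
    (hn : n ≤ S.card) (hinj : Set.InjOn Prod.fst (S : Set Pt))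
    (hmono : ∀ p ∈ S, ∀ q ∈ S, p.1 < q.1 → p.2 ≤ q.2) : HasUpRun P n := by
  have hcard : n ≤ (S.image Prod.fst).card := by rwa [Finset.card_image_of_injOn hinj]
  let e := Finset.orderEmbOfCardLe (S.image Prod.fst) hcard
  have he : ∀ i, ∃ p ∈ S, p.1 = e i := fun i =>
    Finset.mem_image.1 (Finset.orderEmbOfCardLe_mem _ hcard i)
  choose f hfS hfe using he
  have hlt : StrictMono fun i => (f i).1 := by
    intro i j hij
    simpa only [hfe] using e.strictMono hij
  refine ⟨f, fun i => hSP _ (hfS i), hlt, fun i j hij => ?_⟩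
  rcases hij.eq_or_lt with rfl | hij
  · exact le_rfl
  · exact hmono _ (hfS i) _ (hfS j) (hlt hij)

/-- Playing always at a cut, player A forces an `m`-up-run: the points on the tiers `2i + 1` and
`2i + 2` form an up-run for every `i`. -/
lemma hasUpRun_of_cut {m k : ℕ} {sA : AStrat} (hA : AValid sA)
    (hcut : ∀ h, (∃ z, IsCut h z) → IsCut h (sA h)) {sB : BStrat} (hB : BTierValid k sB) :
    HasUpRun (played sA sB (k / 2 * (m - 1) + 1)) m := by
  set N := k / 2 * (m - 1) + 1 with hN
  obtain ⟨z, hz⟩ := exists_isCut_hist hcut sB N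
  have htier := exists_tier_of_mem_hist hB sA N
  have hnodup := nodup_map_fst_hist hA sB N
  have hcard : (hist sA sB N).toFinset.card = N := by
    rw [List.toFinset_card_of_nodup hnodup.of_map, length_hist]
  have hmaps : ∀ p ∈ (hist sA sB N).toFinset,
      (⌊p.2⌋₊ - 1) / 2 ∈ Finset.range (k / 2) := by
    intro p hp
    obtain ⟨j, hj1, hjk, hj⟩ := htier p (List.mem_toFinset.1 hp)
    rw [hj, Nat.floor_natCast, Finset.mem_range]
    omega
  obtain ⟨i, -, hi⟩ := Finset.exists_lt_card_fiber_of_mul_lt_card_of_maps_to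
    (n := m - 1) hmaps (by rw [hcard, Finset.card_range]; omega)
  refine hasUpRun_of_finset _ (fun p hp => List.mem_toFinset.1 (Finset.mem_filter.1 hp).1)
    (Nat.le_of_pred_lt hi) (fun p hp q hq hpq => ?_) fun p hp q hq hpq => ?_
  · exact List.inj_on_of_nodup_map hnodup (List.mem_toFinset.1 (Finset.mem_filter.1 hp).1)
      (List.mem_toFinset.1 (Finset.mem_filter.1 hq).1) hpq
  · obtain ⟨hp, hpi⟩ := Finset.mem_filter.1 hp
    obtain ⟨hq, hqi⟩ := Finset.mem_filter.1 hq
    rw [List.mem_toFinset] at hp hq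
    obtain ⟨a, ha1, -, ha⟩ := htier p hp
    obtain ⟨b, hb1, -, hb⟩ := htier q hq
    rw [ha, Nat.floor_natCast] at hpi
    rw [hb, Nat.floor_natCast] at hqi
    have hab : Odd b → Odd a := by
      rw [← oddTier_iff ha, ← oddTier_iff hb]
      intro hbo
      by_contra hao
      exact absurd (((hz.2 q hq).1 hbo).trans ((hz.2 p hp).2 hao)) hpq.not_gt
    rw [ha, hb, Nat.cast_le]
    rw [Nat.odd_iff, Nat.odd_iff] at hab
    omega

theorem BNum_upper (m k : ℕ) (hm : 1 ≤ m) (hk : 2 ≤ k) :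
    BNum m k ≤ k / 2 * (m - 1) + 1 ∧
    ∃ sA : AStrat, AWinsTierBy m k (k / 2 * (m - 1) + 1) sA := by
  choose sA hvalid hcut using exists_cut_move
  have hwin : AWinsTierBy m k (k / 2 * (m - 1) + 1) sA :=
    ⟨hvalid, fun _ hB => hasUpRun_of_cut hvalid hcut hB⟩
  exact ⟨Nat.sInf_le ⟨sA, hwin⟩, sA, hwin⟩
end

section
/- For every even integer k ≥ 4 and every integer m ≥ k, B(m,k) ≥ (k/2)·(m−k+5) − 3. -/
open Set

/-- Among the elements of `S`, at most `s` have fewer than `s` elements of `S` strictly above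
them with respect to an injective real-valued function. -/
lemma card_filter_card_lt_le {α : Type*} (S : Finset α) (f : α → ℝ)
    (hf : InjOn f S) (s : ℕ) :
    (S.filter fun a => (S.filter fun u => f a < f u).card < s).card ≤ s := by
  classical
  set B := S.filter fun a => (S.filter fun u => f a < f u).card < s with hB
  rcases B.eq_empty_or_nonempty with h | h
  · simp [h]
  obtain ⟨a, ha, hmin⟩ := B.exists_min_image f h
  have haS := Finset.mem_filter.1 ha
  have hsub : B.erase a ⊆ S.filter fun u => f a < f u := by
    intro u hu
    obtain ⟨hne, huB⟩ := Finset.mem_erase.1 hu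
    have huS := (Finset.mem_filter.1 huB).1
    refine Finset.mem_filter.2 ⟨huS, lt_of_le_of_ne (hmin u huB) fun h => hne ?_⟩
    exact (hf haS.1 huS h).symm
  have h1 := Finset.card_le_card hsub
  have h2 := Finset.card_erase_add_one ha
  have h3 := haS.2
  omega

/-- The points of `Q` whose `x`-coordinate lies strictly between `a` and `b`. -/
noncomputable def strictlyBetween (Q : Finset Pt) (a b : ℝ) : Finset Pt :=
  Q.filter fun u => (a < u.1 ∧ u.1 < b) ∨ (b < u.1 ∧ u.1 < a)

lemma strictlyBetween_comm (Q : Finset Pt) (a b : ℝ) :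
    strictlyBetween Q a b = strictlyBetween Q b a := by
  simp only [strictlyBetween, or_comm]

lemma strictlyBetween_mono {Q Q' : Finset Pt} (h : Q ⊆ Q') (a b : ℝ) :
    strictlyBetween Q a b ⊆ strictlyBetween Q' a b :=
  Finset.filter_subset_filter _ h

/-- The points in the list `h` together with two auxiliary end points of heights `1` and
`2 * t - 1`. -/
noncomputable def withWalls (t : ℕ) (h : List Pt) : Finset Pt :=
  insert (0, 1) (insert (1, 2 * (t : ℝ) - 1) h.toFinset)

/-- Tier `j` is free at `x` if every point of `Q` in tier `j` is separated from `x` by at least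
`t - 1` points of `Q`. -/
def IsFreeTier (t : ℕ) (Q : Finset Pt) (x : ℝ) (j : ℕ) : Prop :=
  1 ≤ j ∧ j ≤ 2 * t - 1 ∧ ∀ p ∈ Q, p.2 = j → t - 1 ≤ (strictlyBetween Q p.1 x).card

lemma exists_isFreeTier {t : ℕ} (ht : 1 ≤ t) (Q : Finset Pt) (hQ : InjOn Prod.fst (Q : Set Pt))
    (x : ℝ) (hx : ∀ p ∈ Q, p.1 ≠ x) : ∃ j, IsFreeTier t Q x j := by
  classical
  set near := Q.filter fun p => (strictlyBetween Q p.1 x).card < t - 1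
  have hcard : near.card ≤ (t - 1) + (t - 1) := by
    have hsub : near ⊆
        ((Q.filter fun p => p.1 < x).filter fun p =>
          ((Q.filter fun p => p.1 < x).filter fun u => p.1 < u.1).card < t - 1) ∪
        ((Q.filter fun p => x < p.1).filter fun p =>
          ((Q.filter fun p => x < p.1).filter fun u => -p.1 < -u.1).card < t - 1) := by
      intro p hp
      obtain ⟨hpQ, hpc⟩ := Finset.mem_filter.1 hp
      rcases lt_or_gt_of_ne (hx p hpQ) with h | h
      · refine Finset.mem_union_left _ (Finset.mem_filter.2
          ⟨Finset.mem_filter.2 ⟨hpQ, h⟩, lt_of_le_of_lt (Finset.card_le_card ?_) hpc⟩)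
        intro u hu
        simp only [Finset.mem_filter, strictlyBetween] at hu ⊢
        exact ⟨hu.1.1, Or.inl ⟨hu.2, hu.1.2⟩⟩
      · refine Finset.mem_union_right _ (Finset.mem_filter.2
          ⟨Finset.mem_filter.2 ⟨hpQ, h⟩, lt_of_le_of_lt (Finset.card_le_card ?_) hpc⟩)
        intro u hu
        simp only [Finset.mem_filter, strictlyBetween, neg_lt_neg_iff] at hu ⊢
        exact ⟨hu.1.1, Or.inr ⟨hu.1.2, hu.2⟩⟩
    refine (Finset.card_le_card hsub).trans ((Finset.card_union_le _ _).trans (add_le_add ?_ ?_))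
    · exact card_filter_card_lt_le _ (fun p : Pt => p.1)
        (hQ.mono fun p hp => (Finset.mem_filter.1 hp).1) _
    · refine card_filter_card_lt_le _ (fun p : Pt => -p.1) ?_ _
      intro p hp q hq hpq
      exact hQ (Finset.mem_filter.1 hp).1 (Finset.mem_filter.1 hq).1 (neg_injective hpq)
  have hlt : (near.image Prod.snd).card <
      ((Finset.Icc 1 (2 * t - 1)).image fun j : ℕ => (j : ℝ)).card := by
    rw [Finset.card_image_of_injective _ Nat.cast_injective, Nat.card_Icc]
    have := Finset.card_image_le (s := near) (f := Prod.snd)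
    omega
  obtain ⟨y, hy, hyn⟩ := Finset.exists_mem_notMem_of_card_lt_card hlt
  obtain ⟨j, hj, rfl⟩ := Finset.mem_image.1 hy
  obtain ⟨hj1, hj2⟩ := Finset.mem_Icc.1 hj
  refine ⟨j, hj1, hj2, fun p hp hpj => ?_⟩
  by_contra! hlt'
  exact hyn (Finset.mem_image.2 ⟨p, Finset.mem_filter.2 ⟨hp, hlt'⟩, hpj⟩)

open Classical in
/-- Player B's strategy: play a free tier. -/
noncomputable def freeTierStrat (t : ℕ) : BStrat := fun h x =>
  if H : ∃ j, IsFreeTier t (withWalls t h) x j then (H.choose : ℝ) else 1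

lemma freeTierStrat_valid {t : ℕ} (ht : 1 ≤ t) : BTierValid (2 * t) (freeTierStrat t) := by
  intro h x
  unfold freeTierStrat
  split_ifs with H
  · exact ⟨_, H.choose_spec.1, H.choose_spec.2.1, rfl⟩
  · exact ⟨1, le_rfl, by omega, by simp⟩

/-- Points with distinct `x`-coordinates on the tiers `1, …, 2 * t - 1`, any two points of the
same tier being separated by at least `t - 1` points. -/
structure IsSpaced (t : ℕ) (Q : Finset Pt) : Prop where
  injOn : InjOn Prod.fst (Q : Set Pt)
  tier : ∀ p ∈ Q, ∃ j : ℕ, 1 ≤ j ∧ j ≤ 2 * t - 1 ∧ p.2 = j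
  spaced : ∀ p ∈ Q, ∀ q ∈ Q, p.1 < q.1 → p.2 = q.2 → t - 1 ≤ (strictlyBetween Q p.1 q.1).card

lemma IsSpaced.insert {t : ℕ} {Q : Finset Pt} (hQ : IsSpaced t Q) {x : ℝ}
    (hx : ∀ p ∈ Q, p.1 ≠ x) {j : ℕ} (hj : IsFreeTier t Q x j) :
    IsSpaced t (insert (x, (j : ℝ)) Q) := by
  have hsub : Q ⊆ Insert.insert (x, (j : ℝ)) Q := Finset.subset_insert _ _
  refine ⟨?_, ?_, ?_⟩
  · rw [Finset.coe_insert, injOn_insert]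
    · refine ⟨hQ.injOn, ?_⟩
      rintro ⟨p, hp, hpx⟩
      exact hx p hp hpx
    · intro h
      exact hx _ h rfl
  · intro p hp
    rcases Finset.mem_insert.1 hp with rfl | hp
    · exact ⟨j, hj.1, hj.2.1, rfl⟩
    · exact hQ.tier p hp
  · intro p hp q hq hpq hy
    refine le_trans ?_ (Finset.card_le_card (strictlyBetween_mono hsub _ _))
    rcases Finset.mem_insert.1 hp with rfl | hp <;> rcases Finset.mem_insert.1 hq with rfl | hq
    · exact absurd hpq (lt_irrefl _)
    · rw [strictlyBetween_comm]
      exact hj.2.2 q hq hy.symm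
    · exact hj.2.2 p hp hy
    · exact hQ.spaced p hp q hq hpq hy

lemma withWalls_append (t : ℕ) (h : List Pt) (p : Pt) :
    withWalls t (h ++ [p]) = insert p (withWalls t h) := by
  ext q
  simp only [withWalls, Finset.mem_insert, List.mem_toFinset, List.mem_append, List.mem_singleton]
  tauto

lemma isSpaced_withWalls_nil {t : ℕ} (ht : 2 ≤ t) : IsSpaced t (withWalls t []) := by
  have hmem : ∀ p : Pt, p ∈ withWalls t [] ↔ p = (0, 1) ∨ p = (1, 2 * (t : ℝ) - 1) := by
    simp [withWalls]
  have ht' : (2 : ℝ) ≤ t := by exact_mod_cast ht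
  refine ⟨?_, ?_, ?_⟩
  · intro p hp q hq hpq
    rcases (hmem p).1 hp with rfl | rfl <;> rcases (hmem q).1 hq with rfl | rfl <;> simp_all
  · intro p hp
    rcases (hmem p).1 hp with rfl | rfl
    · exact ⟨1, le_rfl, by omega, by simp⟩
    · refine ⟨2 * t - 1, by omega, le_rfl, ?_⟩
      rw [Nat.cast_sub (by omega)]
      push_cast
      ring
  · intro p hp q hq hpq hy
    exfalso
    rcases (hmem p).1 hp with rfl | rfl <;> rcases (hmem q).1 hq with rfl | rfl <;>
      dsimp only at hpq hy <;> linarith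

/-- Against the free tier strategy, the position reached after `n` turns is spaced. -/
lemma isSpaced_hist {t : ℕ} (ht : 2 ≤ t) {sA : AStrat} (hA : AValid sA) (n : ℕ) :
    IsSpaced t (withWalls t (hist sA (freeTierStrat t) n)) ∧
      (withWalls t (hist sA (freeTierStrat t) n)).card = n + 2 ∧
      ∀ p ∈ hist sA (freeTierStrat t) n, p.1 ∈ Ioo (0 : ℝ) 1 := by
  induction n with
  | zero =>
    refine ⟨isSpaced_withWalls_nil ht, ?_, by simp [hist]⟩
    simp [hist, withWalls]
  | succ n ih =>
    obtain ⟨hS, hc, hI⟩ := ih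
    simp only [hist]
    set h := hist sA (freeTierStrat t) n
    set x := sA h
    have hx : ∀ p ∈ withWalls t h, p.1 ≠ x := by
      intro p hp
      have hx01 := (hA h).1
      simp only [withWalls, Finset.mem_insert, List.mem_toFinset] at hp
      rcases hp with rfl | rfl | hp
      · exact hx01.1.ne
      · exact hx01.2.ne'
      · exact ((hA h).2 p hp).symm
    have H := exists_isFreeTier (t := t) (by omega) (withWalls t h) hS.injOn x hx
    have hval : freeTierStrat t h x = (H.choose : ℝ) := by
      unfold freeTierStrat
      rw [dif_pos H]
    rw [withWalls_append, hval]
    refine ⟨hS.insert hx H.choose_spec, ?_, ?_⟩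
    · rw [Finset.card_insert_of_notMem fun hmem => hx _ hmem rfl, hc]
    · intro p hp
      rcases List.mem_append.1 hp with hp | hp
      · exact hI p hp
      · rw [List.mem_singleton.1 hp]
        exact (hA h).1

/-- In a spaced set, every step of an up-run increases the number of points to the left,
weighted by the height, by at least `t`. -/
lemma IsSpaced.step {t : ℕ} (ht : 1 ≤ t) {Q : Finset Pt} (hQ : IsSpaced t Q) {p q : Pt}
    (hp : p ∈ Q) (hq : q ∈ Q) (hx : p.1 < q.1) (hy : p.2 ≤ q.2) :
    ((Q.filter fun u => u.1 ≤ p.1).card : ℝ) + (t - 1) * p.2 + t ≤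
      (Q.filter fun u => u.1 ≤ q.1).card + (t - 1) * q.2 := by
  classical
  have ht' : (1 : ℝ) ≤ t := by exact_mod_cast ht
  have hcount : (Q.filter fun u => u.1 ≤ p.1).card + (strictlyBetween Q p.1 q.1).card + 1 ≤
      (Q.filter fun u => u.1 ≤ q.1).card := by
    have hdisj : Disjoint (Q.filter fun u => u.1 ≤ p.1) (strictlyBetween Q p.1 q.1) := by
      rw [Finset.disjoint_left]
      intro u hu hu'
      have h1 := (Finset.mem_filter.1 hu).2
      rcases (Finset.mem_filter.1 hu').2 with h | h <;> linarith [h.1, h.2]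
    have hnot : q ∉ (Q.filter fun u => u.1 ≤ p.1) ∪ strictlyBetween Q p.1 q.1 := by
      intro h
      rcases Finset.mem_union.1 h with h | h
      · linarith [(Finset.mem_filter.1 h).2]
      · rcases (Finset.mem_filter.1 h).2 with h | h <;> linarith [h.1, h.2]
    rw [← Finset.card_union_of_disjoint hdisj, ← Finset.card_insert_of_notMem hnot]
    refine Finset.card_le_card fun u hu => ?_
    rcases Finset.mem_insert.1 hu with rfl | hu
    · exact Finset.mem_filter.2 ⟨hq, le_rfl⟩
    rcases Finset.mem_union.1 hu with h | h
    · have h' := Finset.mem_filter.1 h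
      exact Finset.mem_filter.2 ⟨h'.1, h'.2.trans hx.le⟩
    · have h' := Finset.mem_filter.1 h
      refine Finset.mem_filter.2 ⟨h'.1, ?_⟩
      rcases h'.2 with h | h <;> linarith [h.1, h.2]
  rcases hy.eq_or_lt with hy | hy
  · have hs := hQ.spaced p hp q hq hx hy
    have : (Q.filter fun u => u.1 ≤ p.1).card + t ≤ (Q.filter fun u => u.1 ≤ q.1).card := by omega
    have : ((Q.filter fun u => u.1 ≤ p.1).card : ℝ) + t ≤
      (Q.filter fun u => u.1 ≤ q.1).card := by exact_mod_cast this
    rw [hy]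
    linarith
  · obtain ⟨i, -, -, hi⟩ := hQ.tier p hp
    obtain ⟨j, -, -, hj⟩ := hQ.tier q hq
    have hij : i + 1 ≤ j := by
      rw [hi, hj] at hy
      exact_mod_cast hy
    have hij' : (i : ℝ) + 1 ≤ j := by exact_mod_cast hij
    have : (Q.filter fun u => u.1 ≤ p.1).card + 1 ≤ (Q.filter fun u => u.1 ≤ q.1).card := by omega
    have : ((Q.filter fun u => u.1 ≤ p.1).card : ℝ) + 1 ≤
      (Q.filter fun u => u.1 ≤ q.1).card := by exact_mod_cast this
    rw [hi, hj]
    nlinarith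

/-- An up-run of length `m` between two end points of a spaced set forces many points. -/
lemma IsSpaced.le_card_of_upRun {t m : ℕ} (ht : 1 ≤ t) (hm : 1 ≤ m) {Q : Finset Pt}
    (hQ : IsSpaced t Q) {a b : Pt} (ha : a ∈ Q) (hb : b ∈ Q) {f : Fin m → Pt}
    (hf : ∀ i, f i ∈ Q) (hx : StrictMono fun i => (f i).1) (hy : Monotone fun i => (f i).2)
    (hax : ∀ i, a.1 < (f i).1) (hay : ∀ i, a.2 ≤ (f i).2)
    (hbx : ∀ i, (f i).1 < b.1) (hby : ∀ i, (f i).2 ≤ b.2) :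
    (t : ℝ) * (m + 1) + 1 ≤ Q.card + (t - 1) * (b.2 - a.2) := by
  have key : ∀ i (hi : i < m), ((Q.filter fun u => u.1 ≤ a.1).card : ℝ) + (t - 1) * a.2 +
      t * (i + 1) ≤ (Q.filter fun u => u.1 ≤ (f ⟨i, hi⟩).1).card + (t - 1) * (f ⟨i, hi⟩).2 := by
    intro i
    induction i with
    | zero =>
      intro hi
      have := hQ.step ht ha (hf ⟨0, hi⟩) (hax _) (hay _)
      push_cast
      linarith
    | succ i ih =>
      intro hi
      have h1 := ih (by omega)
      have hlt : (⟨i, by omega⟩ : Fin m) < ⟨i + 1, hi⟩ := by simp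
      have h2 := hQ.step ht (hf ⟨i, by omega⟩) (hf ⟨i + 1, hi⟩) (hx hlt) (hy hlt.le)
      push_cast
      linarith
  have h1 := key (m - 1) (by omega)
  have h2 := hQ.step ht (hf ⟨m - 1, by omega⟩) hb (hbx _) (hby _)
  have h3 : (1 : ℝ) ≤ (Q.filter fun u => u.1 ≤ a.1).card := by
    exact Nat.one_le_cast.2 (Finset.card_pos.2 ⟨a, Finset.mem_filter.2 ⟨ha, le_rfl⟩⟩)
  have h4 : ((Q.filter fun u => u.1 ≤ b.1).card : ℝ) ≤ Q.card := by
    exact_mod_cast Finset.card_filter_le _ _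
  rw [Nat.cast_sub hm] at h1
  push_cast at h1
  linarith

/-- Player A needs many turns against the free tier strategy. -/
lemma le_of_aWinsTierBy {t m N : ℕ} (ht : 2 ≤ t) (hm : 2 * t ≤ m) {sA : AStrat}
    (h : AWinsTierBy m (2 * t) N sA) : t * (m - 2 * t + 5) - 3 ≤ N := by
  obtain ⟨f, hf, hx, hy⟩ := h.2 _ (freeTierStrat_valid (t := t) (by omega))
  obtain ⟨hS, hc, hI⟩ := isSpaced_hist ht h.1 N
  set l := hist sA (freeTierStrat t) N
  have hfQ : ∀ i, f i ∈ withWalls t l := by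
    intro i
    have : f i ∈ l := hf i
    simp [withWalls, this]
  have hbound := hS.le_card_of_upRun (a := (0, 1)) (b := (1, 2 * (t : ℝ) - 1)) (by omega)
    (by omega : 1 ≤ m) (by simp [withWalls]) (by simp [withWalls]) hfQ hx hy
    (fun i => (hI _ (hf i)).1)
    (fun i => by
      obtain ⟨j, hj, -, hj'⟩ := hS.tier _ (hfQ i)
      rw [hj']
      exact Nat.one_le_cast.2 hj)
    (fun i => (hI _ (hf i)).2)
    (fun i => by
      obtain ⟨j, -, hj, hj'⟩ := hS.tier _ (hfQ i)
      have hj1 : j + 1 ≤ 2 * t := by omega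
      have hj2 : (j : ℝ) + 1 ≤ 2 * t := by exact_mod_cast hj1
      rw [hj']
      change (j : ℝ) ≤ 2 * t - 1
      linarith)
  rw [hc] at hbound
  obtain ⟨d, rfl⟩ := Nat.exists_eq_add_of_le hm
  have hsub : 2 * t + d - 2 * t + 5 = d + 5 := by omega
  rw [hsub, Nat.sub_le_iff_le_add]
  push_cast at hbound
  have hreal : (t : ℝ) * (d + 5) ≤ N + 3 := by nlinarith
  exact_mod_cast hreal

lemma exists_aValid : ∃ sA : AStrat, AValid sA := by
  classical
  have hex : ∀ h : List Pt, ∃ x ∈ Ioo (0 : ℝ) 1, ∀ p ∈ h, x ≠ p.1 := by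
    intro h
    obtain ⟨x, hx, hxn⟩ := (Ioo_infinite (zero_lt_one' ℝ)).exists_notMem_finset
      (h.map Prod.fst).toFinset
    refine ⟨x, hx, fun p hp hxp => hxn ?_⟩
    rw [List.mem_toFinset, hxp]
    exact List.mem_map_of_mem hp
  choose sA h1 h2 using hex
  exact ⟨sA, fun h => ⟨h1 h, h2 h⟩⟩

lemma hist_properties {k : ℕ} {sA : AStrat} {sB : BStrat} (hA : AValid sA)
    (hB : BTierValid k sB) (n : ℕ) :
    (hist sA sB n).toFinset.card = n ∧ InjOn Prod.fst {p | p ∈ hist sA sB n} ∧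
      ∀ p ∈ hist sA sB n, ∃ j : ℕ, 1 ≤ j ∧ j ≤ k - 1 ∧ p.2 = j := by
  induction n with
  | zero => simp [hist]
  | succ n ih =>
    obtain ⟨hc, hinj, ht⟩ := ih
    simp only [hist]
    set h := hist sA sB n
    have hfresh := (hA h).2
    have hnot : (sA h, sB h (sA h)) ∉ h := fun hmem => hfresh _ hmem rfl
    refine ⟨?_, ?_, ?_⟩
    · rw [List.toFinset_append]
      simp only [List.toFinset_cons, List.toFinset_nil, insert_empty_eq]
      rw [Finset.card_union_of_disjoint (by simpa using hnot), hc, Finset.card_singleton]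
    · intro p hp q hq hpq
      simp only [mem_ofPred_eq, List.mem_append, List.mem_singleton] at hp hq
      rcases hp with hp | rfl <;> rcases hq with hq | rfl
      · exact hinj hp hq hpq
      · exact absurd hpq.symm (hfresh p hp)
      · exact absurd hpq (hfresh q hq)
      · rfl
    · intro p hp
      rcases List.mem_append.1 hp with hp | hp
      · exact ht p hp
      · rw [List.mem_singleton.1 hp]
        exact hB h (sA h)

/-- By the pigeonhole principle, player A wins the tier game in finitely many turns. -/
lemma exists_aWinsTierBy (m k : ℕ) : ∃ N, ∃ sA : AStrat, AWinsTierBy m k N sA := by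
  classical
  obtain ⟨sA, hA⟩ := exists_aValid
  refine ⟨(k - 1) * m + 1, sA, hA, fun sB hB => ?_⟩
  obtain ⟨hc, hinj, ht⟩ := hist_properties hA hB ((k - 1) * m + 1)
  set l := hist sA sB ((k - 1) * m + 1)
  have hmaps : ∀ p ∈ l.toFinset, p.2 ∈ (Finset.Icc 1 (k - 1)).image fun j : ℕ => (j : ℝ) := by
    intro p hp
    obtain ⟨j, h1, h2, h3⟩ := ht p (List.mem_toFinset.1 hp)
    exact Finset.mem_image.2 ⟨j, Finset.mem_Icc.2 ⟨h1, h2⟩, h3.symm⟩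
  obtain ⟨y, -, hy⟩ := Finset.exists_lt_card_fiber_of_mul_lt_card_of_maps_to (n := m) hmaps (by
    rw [Finset.card_image_of_injective _ Nat.cast_injective, Nat.card_Icc, hc]
    simp)
  set X := (l.toFinset.filter fun p => p.2 = y).image Prod.fst with hX
  have hXc : m ≤ X.card := by
    rw [hX, Finset.card_image_of_injOn]
    · exact hy.le
    · intro p hp q hq
      exact hinj (List.mem_toFinset.1 (Finset.mem_filter.1 hp).1)
        (List.mem_toFinset.1 (Finset.mem_filter.1 hq).1)
  refine ⟨fun i => (X.orderEmbOfCardLe hXc i, y), fun i => ?_, fun i j hij => ?_,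
    fun i j _ => le_rfl⟩
  · obtain ⟨p, hp, hpx⟩ := Finset.mem_image.1 (X.orderEmbOfCardLe_mem hXc i)
    obtain ⟨hpl, hpy⟩ := Finset.mem_filter.1 hp
    have : (X.orderEmbOfCardLe hXc i, y) = p := Prod.ext hpx.symm hpy.symm
    change (X.orderEmbOfCardLe hXc i, y) ∈ l
    rw [this]
    exact List.mem_toFinset.1 hpl
  · exact (X.orderEmbOfCardLe hXc).strictMono hij

theorem BNum_lower_even (m k : ℕ) (hk : 4 ≤ k) (hke : Even k) (hkm : k ≤ m) :
    k / 2 * (m - k + 5) - 3 ≤ BNum m k := by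
  obtain ⟨t, rfl⟩ := hke.two_dvd
  obtain ⟨sA, hA⟩ := Nat.sInf_mem (exists_aWinsTierBy m (2 * t))
  rw [Nat.mul_div_cancel_left t two_pos]
  exact le_of_aWinsTierBy (by omega) hkm hA
end
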